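/- On the GCM graph of type D_n with n ≥ 4, let (a_1,…,a_n) be a strongly dominant position. Set b_{n−1} = a_{n−1} and b_n = a_n when n is even, and b_{n−1} = a_n and b_n = a_{n−1} when n is odd. Then the concatenated firing sequence (s_{n−1}, s_{n−2}, …, s_1), where s_i = (i, i+1, …, n−2, n−1, n, n−2, …, i+1, i) for 1 ≤ i ≤ n−2 and s_{n−1} = (n−1, n), is a legal firing sequence from (a_1,…,a_n), and the resulting position is (−a_1, −a_2, …, −a_{n−2}, −b_{n−1}, −b_n). -/

import Mathlib

/-- Firing node `i` transforms the position `lam` by `lam j ↦ lam j - M i j * lam i`. -/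
def fire (M : ℕ → ℕ → ℤ) (lam : ℕ → ℝ) (i : ℕ) : ℕ → ℝ :=
  fun j => lam j - (M i j : ℝ) * lam i

/-- The position obtained from `lam` by firing the nodes of a list in order. -/
def fireList (M : ℕ → ℕ → ℤ) : (ℕ → ℝ) → List ℕ → (ℕ → ℝ)
  | lam, [] => lam
  | lam, i :: s => fireList M (fire M lam i) s

/-- A list of node firings is legal from `lam` (on the graph with node set `{1,…,n}`)
if each fired node is a node of the graph carrying a positive number at the time of firing. -/
def LegalSeq (n : ℕ) (M : ℕ → ℕ → ℤ) : (ℕ → ℝ) → List ℕ → Prop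
  | _, [] => True
  | lam, i :: s => 1 ≤ i ∧ i ≤ n ∧ 0 < lam i ∧ LegalSeq n M (fire M lam i) s

/-- The GCM of type `A n` on nodes `{1,…,n}` (extended by zero off the node set). -/
def MtypeA (n : ℕ) : ℕ → ℕ → ℤ := fun i j =>
  if i = j then 2
  else if 1 ≤ i ∧ i ≤ n ∧ 1 ≤ j ∧ j ≤ n ∧ (i + 1 = j ∨ j + 1 = i) then -1
  else 0

/-- The GCM of type `B n` on nodes `{1,…,n}`: as type `A n` except `M (n-1) n = -2`. -/
def MtypeB (n : ℕ) : ℕ → ℕ → ℤ := fun i j =>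
  if i = j then 2
  else if 1 ≤ i ∧ i + 1 = j ∧ j ≤ n then (if j = n then -2 else -1)
  else if 1 ≤ j ∧ j + 1 = i ∧ i ≤ n then -1
  else 0

/-- The GCM of type `C n` on nodes `{1,…,n}`: as type `A n` except `M n (n-1) = -2`. -/
def MtypeC (n : ℕ) : ℕ → ℕ → ℤ := fun i j =>
  if i = j then 2
  else if 1 ≤ i ∧ i + 1 = j ∧ j ≤ n then -1
  else if 1 ≤ j ∧ j + 1 = i ∧ i ≤ n then (if i = n then -2 else -1)
  else 0

/-- The GCM of type `D n` on nodes `{1,…,n}`: a path `1,…,n-1` together with the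
edge `{n-2, n}`, all amplitudes `-1`. -/
def MtypeD (n : ℕ) : ℕ → ℕ → ℤ := fun i j =>
  if i = j then 2
  else if (1 ≤ i ∧ i + 1 = j ∧ j ≤ n - 1) ∨ (1 ≤ j ∧ j + 1 = i ∧ i ≤ n - 1) then -1
  else if (i = n - 2 ∧ j = n) ∨ (j = n - 2 ∧ i = n) then -1
  else 0

/-- The firing sequence `(s_{n-1}, s_{n-2}, …, s_1)` of Lemma 2.2.D, where
`s_i = (i, i+1, …, n-2, n-1, n, n-2, …, i+1, i)` for `1 ≤ i ≤ n-2` and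
`s_{n-1} = (n-1, n)`. -/
def seqD1 (n : ℕ) : List ℕ :=
  ((List.range' 1 (n - 1)).reverse).flatMap fun i =>
    List.range' i (n + 1 - i) ++ (List.range' i (n - 1 - i)).reverse

/-- `x` are orthogonal coordinates of the type `D n` position `lam`: the simple roots are
`e j - e (j + 1)` for `j < n`, and `e (n - 1) + e n`. -/
def HasCoords (n : ℕ) (lam x : ℕ → ℝ) : Prop :=
  (∀ j, 1 ≤ j → j < n → lam j = x j - x (j + 1)) ∧ lam n = x (n - 1) + x n

theorem HasCoords.congr {n : ℕ} (hn : 2 ≤ n) {lam x x' : ℕ → ℝ} (h : HasCoords n lam x)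
    (hx : ∀ k, 1 ≤ k → k ≤ n → x k = x' k) : HasCoords n lam x' := by
  refine ⟨fun j h1 h2 => ?_, ?_⟩
  · rw [h.1 j h1 h2, hx j h1 (by omega), hx (j + 1) (by omega) (by omega)]
  · rw [h.2, hx (n - 1) (by omega) (by omega), hx n (by omega) le_rfl]

theorem HasCoords.fire_of_lt {n : ℕ} (hn : 4 ≤ n) {lam x : ℕ → ℝ} (h : HasCoords n lam x)
    {i : ℕ} (hi : 1 ≤ i) (hin : i < n) :
    HasCoords n (fire (MtypeD n) lam i)
      (fun k => if k = i then x (i + 1) else if k = i + 1 then x i else x k) := by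
  obtain ⟨h1, h2⟩ := h
  refine ⟨fun j hj hjn => ?_, ?_⟩
  · have hM : MtypeD n i j = if i = j then 2 else if i + 1 = j ∨ j + 1 = i then -1 else 0 := by
      unfold MtypeD
      split_ifs <;> first | rfl | omega
    simp only [fire, hM]
    rw [h1 i hi hin, h1 j hj hjn]
    rcases lt_trichotomy j i with hji | rfl | hji
    · by_cases h' : j + 1 = i
      · subst h'
        simp [show j ≠ j + 1 + 1 by omega]
      · simp [show i ≠ j by omega, show i + 1 ≠ j by omega, h', show j ≠ i by omega,
          show j ≠ i + 1 by omega]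
    · simp
      ring
    · by_cases h' : i + 1 = j
      · subst h'
        simp [show i + 1 + 1 ≠ i by omega]
      · simp [show i ≠ j by omega, h', show j ≠ i by omega, show j + 1 ≠ i by omega,
          show j ≠ i + 1 by omega]
  · have hM : MtypeD n i n = if i + 2 = n then -1 else 0 := by
      unfold MtypeD
      split_ifs <;> first | rfl | omega
    simp only [fire, hM]
    rw [h1 i hi hin, h2]
    by_cases h3 : i + 2 = n
    · subst h3
      simp
      ring
    · by_cases h4 : i + 1 = n
      · subst h4
        simp
        ring
      · simp [h3, show n - 1 ≠ i by omega, show n ≠ i by omega, show n - 1 ≠ i + 1 by omega,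
          show n ≠ i + 1 by omega]

theorem HasCoords.fire_last {n : ℕ} (hn : 4 ≤ n) {lam x : ℕ → ℝ} (h : HasCoords n lam x) :
    HasCoords n (fire (MtypeD n) lam n)
      (fun k => if k = n - 1 then -x n else if k = n then -x (n - 1) else x k) := by
  obtain ⟨m, rfl⟩ : ∃ m, n = m + 2 := ⟨n - 2, by omega⟩
  obtain ⟨h1, h2⟩ := h
  refine ⟨fun j hj hjn => ?_, ?_⟩
  · have hM : MtypeD (m + 2) (m + 2) j = if j = m then -1 else 0 := by
      unfold MtypeD
      split_ifs <;> first | rfl | omega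
    simp only [fire, hM]
    rw [h1 j hj hjn, h2]
    by_cases h3 : j = m
    · subst h3
      simp
      ring
    · by_cases h4 : j = m + 1
      · subst h4
        simp
        ring
      · simp [h3, h4, show j ≠ m + 2 by omega]
  · simp only [fire, MtypeD, if_true, h2]
    simp
    ring

theorem fireList_append (M : ℕ → ℕ → ℤ) (s t : List ℕ) (lam : ℕ → ℝ) :
    fireList M lam (s ++ t) = fireList M (fireList M lam s) t := by
  induction s generalizing lam with
  | nil => rfl
  | cons i s ih => exact ih _

theorem legalSeq_append (n : ℕ) (M : ℕ → ℕ → ℤ) (s t : List ℕ) (lam : ℕ → ℝ) :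
    LegalSeq n M lam (s ++ t) ↔ LegalSeq n M lam s ∧ LegalSeq n M (fireList M lam s) t := by
  induction s generalizing lam with
  | nil => simp [LegalSeq, fireList]
  | cons i s ih => simp [LegalSeq, fireList, ih, and_assoc]

/-- Firing `i, …, i + m - 1` carries the coordinate at `i` rightwards to `i + m`. -/
theorem HasCoords.fire_range' {n : ℕ} (hn : 4 ≤ n) (m : ℕ) {lam x : ℕ → ℝ}
    (h : HasCoords n lam x) {i : ℕ} (hi : 1 ≤ i) (him : i + m ≤ n)
    (hx : ∀ k, i < k → k ≤ i + m → x k < x i) :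
    LegalSeq n (MtypeD n) lam (List.range' i m) ∧
    HasCoords n (fireList (MtypeD n) lam (List.range' i m))
      (fun k => if i ≤ k ∧ k < i + m then x (k + 1) else if k = i + m then x i else x k) := by
  induction m generalizing lam x i with
  | zero =>
    refine ⟨trivial, h.congr (by omega) fun k _ _ => ?_⟩
    by_cases hk : k = i
    · simp [hk]
    · simp [hk, show ¬(i ≤ k ∧ k < i) by omega]
  | succ m ih =>
    have h' := h.fire_of_lt hn hi (by omega)
    obtain ⟨hl, hc⟩ := ih h' (i := i + 1) (by omega) (by omega) (fun k hk hkm => by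
      simpa [show k ≠ i by omega, show k ≠ i + 1 by omega] using hx k (by omega) (by omega))
    refine ⟨⟨hi, by omega, ?_, hl⟩, hc.congr (by omega) fun k _ _ => ?_⟩
    · rw [h.1 i hi (by omega)]
      exact sub_pos.2 (hx _ (by omega) (by omega))
    · split_ifs <;> first | omega | rfl | (congr 1; omega)

/-- Firing `i + m - 1, …, i` carries the coordinate at `i + m` leftwards to `i`. -/
theorem HasCoords.fire_reverse_range' {n : ℕ} (hn : 4 ≤ n) (m : ℕ) {lam x : ℕ → ℝ}
    (h : HasCoords n lam x) {i : ℕ} (hi : 1 ≤ i) (him : i + m ≤ n)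
    (hx : ∀ k, i ≤ k → k < i + m → x (i + m) < x k) :
    LegalSeq n (MtypeD n) lam (List.range' i m).reverse ∧
    HasCoords n (fireList (MtypeD n) lam (List.range' i m).reverse)
      (fun k => if i < k ∧ k ≤ i + m then x (k - 1) else if k = i then x (i + m) else x k) := by
  induction m generalizing lam x with
  | zero =>
    refine ⟨trivial, h.congr (by omega) fun k _ _ => ?_⟩
    by_cases hk : k = i
    · simp [hk]
    · simp [hk, show ¬(i < k ∧ k ≤ i) by omega]
  | succ m ih =>
    rw [List.range'_concat, List.reverse_append, List.reverse_singleton, List.singleton_append,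
      one_mul]
    have h' := h.fire_of_lt hn (i := i + m) (by omega) (by omega)
    obtain ⟨hl, hc⟩ := ih h' (by omega) (fun k hk hkm => by
      simpa [show k ≠ i + m by omega, show k ≠ i + m + 1 by omega, ← add_assoc]
        using hx k (by omega) (by omega : k < i + (m + 1)))
    refine ⟨⟨by omega, by omega, ?_, hl⟩, hc.congr (by omega) fun k _ _ => ?_⟩
    · rw [h.1 _ (by omega) (by omega)]
      exact sub_pos.2 (hx _ (by omega) (by omega))
    · split_ifs <;> first | omega | rfl | (congr 1; omega)

/-- Coordinates `y` with the entries strictly between `i` and `n` negated and the last entry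
multiplied by `e`. -/
def partialNeg (n : ℕ) (y : ℕ → ℝ) (i : ℕ) (e : ℝ) : ℕ → ℝ :=
  fun k => if k = n then e * y n else if k ≤ i then y k else -y k

theorem HasCoords.fire_block {n : ℕ} (hn : 4 ≤ n) {lam y : ℕ → ℝ}
    (hlt : ∀ i k, 1 ≤ i → i < k → k ≤ n → y k < y i)
    (hadd : ∀ i k, 1 ≤ i → i < k → k ≤ n → 0 < y i + y k)
    {i : ℕ} (hi : i + 2 ≤ n) {e : ℝ} (he : e = 1 ∨ e = -1)
    (h : HasCoords n lam (partialNeg n y (i + 1) e)) :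
    LegalSeq n (MtypeD n) lam
      (List.range' (i + 1) (n + 1 - (i + 1)) ++ (List.range' (i + 1) (n - 1 - (i + 1))).reverse) ∧
    HasCoords n (fireList (MtypeD n) lam
      (List.range' (i + 1) (n + 1 - (i + 1)) ++ (List.range' (i + 1) (n - 1 - (i + 1))).reverse))
      (partialNeg n y i (-e)) := by
  have hmul : ∀ j, 1 ≤ j → j < n → e * y n < y j ∧ 0 < y j + e * y n := fun j h1 h2 => by
    have := hlt j n h1 h2 le_rfl
    have := hadd j n h1 h2 le_rfl
    rcases he with rfl | rfl <;> constructor <;> linarith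
  obtain ⟨m, rfl⟩ : ∃ m, n = i + 2 + m := ⟨n - (i + 2), by omega⟩
  rw [show i + 2 + m + 1 - (i + 1) = (m + 1) + 1 by omega,
    show i + 2 + m - 1 - (i + 1) = m by omega, List.range'_concat, one_mul,
    show i + 1 + (m + 1) = i + 2 + m by omega]
  obtain ⟨hl1, hc1⟩ := h.fire_range' hn (m + 1) (i := i + 1) (by omega) (by omega)
    (fun k hk hkm => by
      have := hlt (i + 1) k (by omega) hk (by omega)
      have := hadd (i + 1) k (by omega) hk (by omega)
      have := hmul (i + 1) (by omega) (by omega)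
      unfold partialNeg
      split_ifs <;> first | omega | linarith)
  replace hc1 := hc1.congr (x' := fun k => if k ≤ i then y k else if k = i + 1 + m then
      e * y (i + 2 + m) else if k = i + 2 + m then y (i + 1) else -y (k + 1)) (by omega)
    fun k _ _ => by
      unfold partialNeg
      split_ifs <;> first | omega | rfl
  have hc2 := (hc1.fire_last hn).congr (x' := fun k => if k ≤ i then y k else
      if k = i + 1 + m then -y (i + 1) else if k = i + 2 + m then -e * y (i + 2 + m)
      else -y (k + 1)) (by omega)
    fun k _ _ => by
      simp only [show i + 2 + m - 1 = i + 1 + m by omega]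
      split_ifs <;> first | omega | rfl | ring
  obtain ⟨hl3, hc3⟩ := hc2.fire_reverse_range' hn m (i := i + 1) (by omega) (by omega)
    (fun k hk hkm => by
      have := hlt (i + 1) (k + 1) (by omega) (by omega) (by omega)
      split_ifs <;> first | omega | linarith)
  simp only [legalSeq_append, fireList_append]
  refine ⟨⟨⟨hl1, by omega, le_rfl, ?_, trivial⟩, hl3⟩, hc3.congr (by omega) fun k hk _ => ?_⟩
  · rw [hc1.2]
    have := hmul (i + 1) (by omega) (by omega)
    simp only [show i + 2 + m - 1 = i + 1 + m by omega]
    split_ifs <;> first | omega | linarith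
  · unfold partialNeg
    split_ifs <;> first
      | omega
      | rfl
      | rw [Nat.sub_add_cancel hk]
      | (congr 2; omega)

theorem HasCoords.fire_blocks {n : ℕ} (hn : 4 ≤ n) {y : ℕ → ℝ}
    (hlt : ∀ i k, 1 ≤ i → i < k → k ≤ n → y k < y i)
    (hadd : ∀ i k, 1 ≤ i → i < k → k ≤ n → 0 < y i + y k)
    (m : ℕ) (hm : m + 1 ≤ n) {e : ℝ} (he : e = 1 ∨ e = -1) {lam : ℕ → ℝ}
    (h : HasCoords n lam (partialNeg n y m e)) :
    LegalSeq n (MtypeD n) lam ((List.range' 1 m).reverse.flatMap fun i =>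
      List.range' i (n + 1 - i) ++ (List.range' i (n - 1 - i)).reverse) ∧
    HasCoords n (fireList (MtypeD n) lam ((List.range' 1 m).reverse.flatMap fun i =>
      List.range' i (n + 1 - i) ++ (List.range' i (n - 1 - i)).reverse))
      (partialNeg n y 0 ((-1) ^ m * e)) := by
  induction m generalizing e lam with
  | zero => simpa [LegalSeq, fireList] using h
  | succ m ih =>
    rw [List.range'_concat, List.reverse_append, List.reverse_singleton, List.singleton_append,
      one_mul, List.flatMap_cons, add_comm 1 m]
    obtain ⟨hl1, hc1⟩ := h.fire_block hn hlt hadd (by omega) he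
    obtain ⟨hl2, hc2⟩ := ih (by omega) (by rcases he with rfl | rfl <;> simp) hc1
    refine ⟨(legalSeq_append _ _ _ _ _).2 ⟨hl1, hl2⟩, ?_⟩
    rwa [fireList_append, show (-1 : ℝ) ^ (m + 1) * e = (-1) ^ m * -e by ring]

theorem exists_hasCoords {n : ℕ} (hn : 2 ≤ n) (a : ℕ → ℝ) : ∃ y, HasCoords n a y := by
  refine ⟨fun k => if k = n then (a n - a (n - 1)) / 2
    else ∑ j ∈ Finset.Ico k (n - 1), a j + (a (n - 1) + a n) / 2, fun j _ h2 => ?_, ?_⟩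
  · by_cases h : j + 1 = n
    · subst h
      simp
      ring
    · simp only [h, h2.ne, if_false]
      rw [Finset.sum_eq_sum_Ico_succ_bot (by omega)]
      ring
  · simp [show n - 1 ≠ n by omega]
    ring

theorem HasCoords.lt_of_pos {n : ℕ} {a y : ℕ → ℝ} (h : HasCoords n a y)
    (ha : ∀ i, 1 ≤ i → i ≤ n → 0 < a i) (i k : ℕ) (hi : 1 ≤ i) (hik : i < k) (hk : k ≤ n) :
    y k < y i := by
  induction k, hik using Nat.le_induction with
  | base => linarith [h.1 i hi (by omega), ha i hi (by omega)]
  | succ k hik ih =>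
    have hik : i < k := hik
    linarith [h.1 k (by omega) (by omega), ha k (by omega) (by omega), ih (by omega)]

theorem HasCoords.add_pos_of_pos {n : ℕ} {a y : ℕ → ℝ} (h : HasCoords n a y)
    (ha : ∀ i, 1 ≤ i → i ≤ n → 0 < a i) (i k : ℕ) (hi : 1 ≤ i) (hik : i < k) (hk : k ≤ n) :
    0 < y i + y k := by
  have hn := ha n (by omega) le_rfl
  rw [h.2] at hn
  have h1 : y (n - 1) ≤ y i := by
    rcases eq_or_ne i (n - 1) with rfl | hne
    · exact le_rfl
    · exact (h.lt_of_pos ha i (n - 1) hi (by omega) (by omega)).le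
  have h2 : y n ≤ y k := by
    rcases eq_or_ne k n with rfl | hne
    · exact le_rfl
    · exact (h.lt_of_pos ha k n (by omega) (by omega) le_rfl).le
  linarith

/-- On type `D n` (`n ≥ 4`), from a strongly dominant position `(a 1, …, a n)` the
firing sequence `(s_{n-1}, …, s_1)` is legal and yields the position
`(-a 1, -a 2, …, -a (n-2), -b (n-1), -b n)`, where `b (n-1) = a (n-1)` and
`b n = a n` when `n` is even, and `b (n-1) = a n` and `b n = a (n-1)` when `n` is odd. -/
theorem typeD_from1 (n : ℕ) (hn : 4 ≤ n) (a : ℕ → ℝ)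
    (ha : ∀ i, 1 ≤ i → i ≤ n → 0 < a i) :
    LegalSeq n (MtypeD n) a (seqD1 n) ∧
    (∀ j, 1 ≤ j → j ≤ n - 2 → fireList (MtypeD n) a (seqD1 n) j = -(a j)) ∧
    fireList (MtypeD n) a (seqD1 n) (n - 1)
      = -(if n % 2 = 0 then a (n - 1) else a n) ∧
    fireList (MtypeD n) a (seqD1 n) n
      = -(if n % 2 = 0 then a n else a (n - 1)) := by
  obtain ⟨y, hy⟩ := exists_hasCoords (n := n) (by omega) a
  obtain ⟨hl, hc1, hc2⟩ := (hy.congr (x' := partialNeg n y (n - 1) 1) (by omega)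
    fun k _ hk => by
      unfold partialNeg
      split_ifs with h1
      · rw [h1, one_mul]
      · rfl
      · omega).fire_blocks hn (hy.lt_of_pos ha) (hy.add_pos_of_pos ha) (n - 1) (by omega)
        (Or.inl rfl)
  refine ⟨hl, fun j h1 h2 => (hc1 j h1 (by omega)).trans ?_,
    (hc1 (n - 1) (by omega) (by omega)).trans ?_, hc2.trans ?_⟩
  · rw [hy.1 j h1 (by omega)]
    simp [partialNeg, show j ≠ n by omega, show j + 1 ≠ n by omega, show j ≠ 0 by omega]
    ring
  all_goals
    rw [hy.1 (n - 1) (by omega) (by omega), hy.2, show n - 1 + 1 = n by omega]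
    simp only [partialNeg, show n - 1 ≠ n by omega, show ¬ n - 1 ≤ 0 by omega, if_false, if_true]
    split_ifs with h
    · rw [Odd.neg_one_pow (Nat.odd_iff.2 (by omega))]
      ring
    · rw [Even.neg_one_pow (Nat.even_iff.2 (by omega))]
      ring
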